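/- Let m > 1/2 and define b(ε) = inf{ K(θ'‖0) : |θ'| > ε } where K is the Kullback–Leibler divergence between Pearson Type VII location models as above. Then b(ε) = m·(F_m(ε) − F_m(0)) for every ε > 0, and lim_{ε→0⁺} b(ε)/ε² = m(2m−1)/(2(m+1)). -/

import Mathlib

open MeasureTheory Filter

noncomputable def pearsonC (m : ℝ) : ℝ := (∫ x : ℝ, (1 + x ^ 2) ^ (-m))⁻¹

noncomputable def pearsonPdf (m θ : ℝ) (x : ℝ) : ℝ :=
  pearsonC m * (1 + (x - θ) ^ 2) ^ (-m)

noncomputable def pearsonF (m : ℝ) (t : ℝ) : ℝ :=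
  ∫ x : ℝ, Real.log (1 + (x - t) ^ 2) * (pearsonC m * (1 + x ^ 2) ^ (-m))

noncomputable def pearsonKL (m θ₁ θ₂ : ℝ) : ℝ :=
  ∫ x : ℝ, Real.log (pearsonPdf m θ₁ x / pearsonPdf m θ₂ x) * pearsonPdf m θ₁ x

/-- `b(ε) = inf { K(θ'‖0) : |θ'| > ε }`. -/
noncomputable def pearsonB (m ε : ℝ) : ℝ :=
  sInf {k : ℝ | ∃ θ' : ℝ, ε < |θ'| ∧ k = pearsonKL m θ' 0}

lemma integrable_one_add_sq_rpow_neg {m : ℝ} (hm : 1 / 2 < m) :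
    Integrable fun x : ℝ => (1 + x ^ 2) ^ (-m) := by
  have h := integrable_rpow_neg_one_add_norm_sq (E := ℝ) (μ := volume) (r := 2 * m)
    (by simp; linarith)
  refine h.congr (Eventually.of_forall fun x => ?_)
  simp only [Real.norm_eq_abs, sq_abs]
  congr 1
  ring

lemma continuous_one_add_sq_rpow (s : ℝ) : Continuous fun x : ℝ => (1 + x ^ 2) ^ s :=
  Continuous.rpow_const (by fun_prop) fun x => Or.inl (by positivity)

lemma integral_one_add_sq_rpow_neg_pos {m : ℝ} (hm : 1 / 2 < m) :
    0 < ∫ x : ℝ, (1 + x ^ 2) ^ (-m) :=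
  integral_pos_of_integrable_nonneg_nonzero (x := 0) (continuous_one_add_sq_rpow _)
    (integrable_one_add_sq_rpow_neg hm) (fun x => by positivity) (by simp)

lemma pearsonC_pos {m : ℝ} (hm : 1 / 2 < m) : 0 < pearsonC m :=
  inv_pos.2 (integral_one_add_sq_rpow_neg_pos hm)

lemma integrable_log_mul_one_add_sq_rpow_neg {m : ℝ} (hm : 1 / 2 < m) :
    Integrable fun x : ℝ => Real.log (1 + x ^ 2) * (1 + x ^ 2) ^ (-m) := by
  obtain ⟨δ, hδ, hδm⟩ : ∃ δ : ℝ, 0 < δ ∧ 1 / 2 < m - δ :=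
    ⟨(m - 1 / 2) / 2, by linarith, by linarith⟩
  refine ((integrable_one_add_sq_rpow_neg hδm).div_const δ).mono' ?_
    (Eventually.of_forall fun x => ?_)
  · refine (Continuous.mul ?_ (continuous_one_add_sq_rpow _)).aestronglyMeasurable
    exact Continuous.log (by fun_prop) fun x => by positivity
  · have h1 : (1 : ℝ) ≤ 1 + x ^ 2 := by nlinarith [sq_nonneg x]
    have h0 : (0 : ℝ) < 1 + x ^ 2 := by linarith
    have hp := Real.rpow_nonneg h0.le (-m)
    rw [Real.norm_eq_abs, abs_of_nonneg (mul_nonneg (Real.log_nonneg h1) hp)]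
    calc _ ≤ ((1 + x ^ 2) ^ δ / δ) * (1 + x ^ 2) ^ (-m) :=
          mul_le_mul_of_nonneg_right (Real.log_le_rpow_div h0.le hδ) hp
      _ = _ := by
          rw [div_mul_eq_mul_div, ← Real.rpow_add h0]
          congr 2
          ring

lemma log_one_add_sub_sq_le {t T : ℝ} (h : |t| ≤ T) (x : ℝ) :
    Real.log (1 + (x - t) ^ 2) ≤ Real.log (2 * (1 + T ^ 2)) + Real.log (1 + x ^ 2) := by
  rw [← Real.log_mul (by positivity) (by positivity)]
  apply Real.log_le_log (by positivity)
  have : t ^ 2 ≤ T ^ 2 := sq_le_sq' (by linarith [neg_abs_le t]) ((le_abs_self t).trans h)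
  nlinarith [sq_nonneg (x + t), mul_nonneg (sq_nonneg T) (sq_nonneg x)]

lemma continuous_log_one_add_sub_sq (t : ℝ) :
    Continuous fun x : ℝ => Real.log (1 + (x - t) ^ 2) :=
  Continuous.log (by fun_prop) fun x => by positivity

lemma integrable_pearsonF_bound {m : ℝ} (hm : 1 / 2 < m) (A : ℝ) :
    Integrable fun x : ℝ =>
      (A + Real.log (1 + x ^ 2)) * (pearsonC m * (1 + x ^ 2) ^ (-m)) := by
  refine ((((integrable_one_add_sq_rpow_neg hm).const_mul A).add
    (integrable_log_mul_one_add_sq_rpow_neg hm)).const_mul (pearsonC m)).congr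
    (Eventually.of_forall fun x => ?_)
  simp only [Pi.add_apply]
  ring

lemma norm_pearsonF_integrand_le {m t T : ℝ} (hm : 1 / 2 < m) (h : |t| ≤ T) (x : ℝ) :
    ‖Real.log (1 + (x - t) ^ 2) * (pearsonC m * (1 + x ^ 2) ^ (-m))‖ ≤
      (Real.log (2 * (1 + T ^ 2)) + Real.log (1 + x ^ 2)) *
        (pearsonC m * (1 + x ^ 2) ^ (-m)) := by
  have hc := pearsonC_pos hm
  have hl : 0 ≤ Real.log (1 + (x - t) ^ 2) :=
    Real.log_nonneg (by nlinarith [sq_nonneg (x - t)])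
  rw [Real.norm_eq_abs, abs_of_nonneg (by positivity)]
  exact mul_le_mul_of_nonneg_right (log_one_add_sub_sq_le h x) (by positivity)

lemma aestronglyMeasurable_pearsonF_integrand (m t : ℝ) :
    AEStronglyMeasurable
      fun x : ℝ => Real.log (1 + (x - t) ^ 2) * (pearsonC m * (1 + x ^ 2) ^ (-m)) :=
  ((continuous_log_one_add_sub_sq t).mul
    ((continuous_one_add_sq_rpow _).const_mul _)).aestronglyMeasurable

lemma integrable_pearsonF_integrand {m : ℝ} (hm : 1 / 2 < m) (t : ℝ) :
    Integrable fun x : ℝ =>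
      Real.log (1 + (x - t) ^ 2) * (pearsonC m * (1 + x ^ 2) ^ (-m)) :=
  (integrable_pearsonF_bound hm _).mono' (aestronglyMeasurable_pearsonF_integrand m t)
    (Eventually.of_forall (norm_pearsonF_integrand_le hm le_rfl))

lemma continuous_pearsonF {m : ℝ} (hm : 1 / 2 < m) : Continuous (pearsonF m) := by
  refine continuous_iff_continuousAt.2 fun s => ?_
  refine continuousAt_of_dominated
    (Eventually.of_forall (aestronglyMeasurable_pearsonF_integrand m)) ?_
    (integrable_pearsonF_bound hm (Real.log (2 * (1 + (|s| + 1) ^ 2))))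
    (Eventually.of_forall fun x => ?_)
  · have : ∀ᶠ t in nhds s, |t| < |s| + 1 :=
      continuous_abs.continuousAt.eventually_lt continuousAt_const (by simp)
    filter_upwards [this] with t ht
    exact Eventually.of_forall (norm_pearsonF_integrand_le hm ht.le)
  · refine ContinuousAt.mul ?_ continuousAt_const
    exact ContinuousAt.log (by fun_prop) (by positivity)

lemma pearsonF_neg (m t : ℝ) : pearsonF m (-t) = pearsonF m t := by
  unfold pearsonF
  rw [← integral_neg_eq_self]
  refine integral_congr_ae (Eventually.of_forall fun x => ?_)
  have h : (-x - -t) ^ 2 = (x - t) ^ 2 := by ring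
  simp only [h, neg_sq]

lemma pearsonKL_zero_eq {m : ℝ} (hm : 1 / 2 < m) (θ : ℝ) :
    pearsonKL m θ 0 = m * (pearsonF m θ - pearsonF m 0) := by
  have hc := pearsonC_pos hm
  rw [← pearsonF_neg m θ]
  unfold pearsonKL pearsonF
  rw [← integral_sub (integrable_pearsonF_integrand hm _) (integrable_pearsonF_integrand hm _),
    ← integral_const_mul, ← integral_add_right_eq_self _ θ]
  refine integral_congr_ae (Eventually.of_forall fun x => ?_)
  have h1 : (0 : ℝ) < 1 + x ^ 2 := by positivity
  have h2 : (0 : ℝ) < 1 + (x + θ) ^ 2 := by positivity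
  simp only [pearsonPdf, sub_zero, sub_neg_eq_add, add_sub_cancel_right]
  rw [mul_div_mul_left _ _ hc.ne', Real.log_div (by positivity) (by positivity),
    Real.log_rpow h1, Real.log_rpow h2]
  ring

/-- The integrand of `pearsonF m t - pearsonF m s`, symmetrized about the midpoint of `s` and `t`,
is nonnegative. -/
lemma pearsonF_le_pearsonF {m s t : ℝ} (hm : 1 / 2 < m) (hs : 0 ≤ s) (hst : s ≤ t) :
    pearsonF m s ≤ pearsonF m t := by
  have hc := pearsonC_pos hm
  set D : ℝ → ℝ := fun x =>
    Real.log (1 + (x - t) ^ 2) * (pearsonC m * (1 + x ^ 2) ^ (-m)) -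
      Real.log (1 + (x - s) ^ 2) * (pearsonC m * (1 + x ^ 2) ^ (-m)) with hD
  have hDi : Integrable D :=
    (integrable_pearsonF_integrand hm _).sub (integrable_pearsonF_integrand hm _)
  have hDint : ∫ x, D x = pearsonF m t - pearsonF m s :=
    integral_sub (integrable_pearsonF_integrand hm _) (integrable_pearsonF_integrand hm _)
  have hrefl : ∫ x, D (s + t - x) = ∫ x, D x := integral_sub_left_eq_self D volume (s + t)
  have hsum : 0 ≤ ∫ x, (D x + D (s + t - x)) := by
    refine integral_nonneg fun x => ?_
    have e1 : (s + t - x - t) ^ 2 = (x - s) ^ 2 := by ring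
    have e2 : (s + t - x - s) ^ 2 = (x - t) ^ 2 := by ring
    have key : D x + D (s + t - x) = pearsonC m *
        ((Real.log (1 + (x - t) ^ 2) - Real.log (1 + (x - s) ^ 2)) *
          ((1 + x ^ 2) ^ (-m) - (1 + (s + t - x) ^ 2) ^ (-m))) := by
      simp only [hD, e1, e2]
      ring
    rw [Pi.zero_apply, key]
    refine mul_nonneg hc.le ?_
    rcases le_total (s + t) (2 * x) with hx | hx
    · refine mul_nonneg_of_nonpos_of_nonpos (sub_nonpos.2 ?_) (sub_nonpos.2 ?_)
      · exact Real.log_le_log (by positivity) (by nlinarith)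
      · exact Real.rpow_le_rpow_of_nonpos (by positivity) (by nlinarith) (by linarith)
    · refine mul_nonneg (sub_nonneg.2 ?_) (sub_nonneg.2 ?_)
      · exact Real.log_le_log (by positivity) (by nlinarith)
      · exact Real.rpow_le_rpow_of_nonpos (by positivity) (by nlinarith) (by linarith)
  rw [integral_add hDi (hDi.comp_sub_left (s + t)), hrefl, hDint] at hsum
  linarith

lemma pearsonB_eq {m ε : ℝ} (hm : 1 / 2 < m) (hε : 0 < ε) :
    pearsonB m ε = m * (pearsonF m ε - pearsonF m 0) := by
  have hm0 : 0 < m := by linarith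
  refine IsGLB.csInf_eq ⟨?_, fun k hk => ?_⟩
    ⟨_, ε + 1, by rw [abs_of_pos] <;> linarith, rfl⟩
  · rintro _ ⟨θ, hθ, rfl⟩
    have habs : pearsonF m |θ| = pearsonF m θ := by
      rcases abs_choice θ with h | h <;> rw [h]
      exact pearsonF_neg m θ
    rw [pearsonKL_zero_eq hm, ← habs]
    gcongr
    exact pearsonF_le_pearsonF hm hε.le hθ.le
  · have hlim : Tendsto (fun θ => m * (pearsonF m θ - pearsonF m 0)) (nhdsWithin ε (Set.Ioi ε))
        (nhds (m * (pearsonF m ε - pearsonF m 0))) :=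
      (((continuous_pearsonF hm).sub continuous_const).const_mul m).continuousWithinAt
    refine ge_of_tendsto hlim ?_
    filter_upwards [self_mem_nhdsWithin] with θ hθ
    rw [← pearsonKL_zero_eq hm]
    exact hk ⟨θ, lt_of_lt_of_le hθ (le_abs_self θ), rfl⟩

lemma tendsto_mul_one_add_sq_rpow_neg {m : ℝ} (hm : 1 / 2 < m) {l : Filter ℝ}
    (hl : Tendsto (fun x : ℝ => 1 + x ^ 2) l atTop) :
    Tendsto (fun x : ℝ => x * (1 + x ^ 2) ^ (-m)) l (nhds 0) := by
  have h := (tendsto_rpow_neg_atTop (show 0 < m - 1 / 2 by linarith)).comp hl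
  refine squeeze_zero_norm (fun x => ?_) h
  have h0 : (0 : ℝ) < 1 + x ^ 2 := by positivity
  have hx : |x| ≤ (1 + x ^ 2) ^ (1 / 2 : ℝ) := by
    rw [← Real.sqrt_eq_rpow]
    exact Real.abs_le_sqrt (by linarith)
  calc ‖x * (1 + x ^ 2) ^ (-m)‖ = |x| * (1 + x ^ 2) ^ (-m) := by
        rw [norm_mul, Real.norm_eq_abs, Real.norm_eq_abs,
          abs_of_nonneg (Real.rpow_nonneg h0.le (-m))]
    _ ≤ (1 + x ^ 2) ^ (1 / 2 : ℝ) * (1 + x ^ 2) ^ (-m) := by gcongr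
    _ = (1 + x ^ 2) ^ (-(m - 1 / 2)) := by
        rw [← Real.rpow_add h0]
        congr 1
        ring

lemma integral_one_add_sq_rpow_neg_succ {m : ℝ} (hm : 1 / 2 < m) :
    2 * m * ∫ x : ℝ, (1 + x ^ 2) ^ (-(m + 1)) =
      (2 * m - 1) * ∫ x : ℝ, (1 + x ^ 2) ^ (-m) := by
  have hi := integrable_one_add_sq_rpow_neg hm
  have hi' := integrable_one_add_sq_rpow_neg (m := m + 1) (by linarith)
  have hd : ∀ x : ℝ, HasDerivAt (fun x : ℝ => x * (1 + x ^ 2) ^ (-m))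
      (2 * m * (1 + x ^ 2) ^ (-(m + 1)) - (2 * m - 1) * (1 + x ^ 2) ^ (-m)) x := by
    intro x
    have h0 : (0 : ℝ) < 1 + x ^ 2 := by positivity
    have h1 : HasDerivAt (fun x : ℝ => 1 + x ^ 2) (2 * x) x := by
      simpa using (hasDerivAt_pow 2 x).const_add 1
    refine ((hasDerivAt_id x).mul (h1.rpow_const (p := -m) (Or.inl h0.ne'))).congr_deriv ?_
    have e : (1 + x ^ 2) ^ (-m) = (1 + x ^ 2) ^ (-(m + 1)) * (1 + x ^ 2) := by
      nth_rewrite 3 [← Real.rpow_one (1 + x ^ 2)]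
      rw [← Real.rpow_add h0]
      congr 1
      ring
    rw [show -m - 1 = -(m + 1) by ring, e, id]
    ring
  have ht : Tendsto (fun x : ℝ => 1 + x ^ 2) atTop atTop :=
    tendsto_atTop_add_const_left _ _ (tendsto_pow_atTop two_ne_zero)
  have hb : Tendsto (fun x : ℝ => 1 + x ^ 2) atBot atTop := by
    simpa [Function.comp_def] using ht.comp tendsto_neg_atBot_atTop
  have h := integral_of_hasDerivAt_of_tendsto hd
    ((hi'.const_mul _).sub (hi.const_mul _))
    (tendsto_mul_one_add_sq_rpow_neg hm hb) (tendsto_mul_one_add_sq_rpow_neg hm ht)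
  rw [integral_sub (hi'.const_mul _) (hi.const_mul _), integral_const_mul,
    integral_const_mul] at h
  linarith

lemma integral_second_deriv_log_mul_pearson {m : ℝ} (hm : 1 / 2 < m) :
    ∫ x : ℝ, 2 * (1 - x ^ 2) / (1 + x ^ 2) ^ 2 * (pearsonC m * (1 + x ^ 2) ^ (-m)) =
      (2 * m - 1) / (m + 1) := by
  have h1 := integral_one_add_sq_rpow_neg_succ hm
  have h2 := integral_one_add_sq_rpow_neg_succ (m := m + 1) (by linarith)
  have hi1 := integrable_one_add_sq_rpow_neg (m := m + 1) (by linarith)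
  have hi2 := integrable_one_add_sq_rpow_neg (m := m + 1 + 1) (by linarith)
  have hI := integral_one_add_sq_rpow_neg_pos hm
  have e : ∀ x : ℝ, 2 * (1 - x ^ 2) / (1 + x ^ 2) ^ 2 * (pearsonC m * (1 + x ^ 2) ^ (-m)) =
      pearsonC m * (4 * (1 + x ^ 2) ^ (-(m + 1 + 1)) - 2 * (1 + x ^ 2) ^ (-(m + 1))) := by
    intro x
    have h0 : (0 : ℝ) < 1 + x ^ 2 := by positivity
    rw [show -(m + 1 + 1) = -m - 1 - 1 by ring, show -(m + 1) = -m - 1 by ring,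
      Real.rpow_sub_one h0.ne' (-m - 1), Real.rpow_sub_one h0.ne']
    field_simp
    ring
  simp only [e]
  rw [integral_const_mul, integral_sub (hi2.const_mul _) (hi1.const_mul _),
    integral_const_mul, integral_const_mul, pearsonC]
  generalize (∫ x : ℝ, (1 + x ^ 2) ^ (-m)) = I at *
  generalize (∫ x : ℝ, (1 + x ^ 2) ^ (-(m + 1))) = J at *
  generalize (∫ x : ℝ, (1 + x ^ 2) ^ (-(m + 1 + 1))) = K at *
  have hm0 : m ≠ 0 := by linarith
  have hm1 : m + 1 ≠ 0 := by linarith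
  have hJ : J = (2 * m - 1) * I / (2 * m) := by
    field_simp
    linarith
  have hK : K = (2 * m + 1) * J / (2 * (m + 1)) := by
    field_simp
    linarith
  rw [hK, hJ]
  field_simp
  ring

/-- `(1 + (x - ε)²) (1 + (x + ε)²) = (1 + x²)² (1 + ε² w)` with `w` as below. -/
noncomputable def logSecondDiffRatio (x ε : ℝ) : ℝ :=
  (2 * (1 - x ^ 2) + ε ^ 2) / (1 + x ^ 2) ^ 2

lemma log_second_difference (x ε : ℝ) :
    Real.log (1 + (x - ε) ^ 2) + Real.log (1 + (x - -ε) ^ 2) - 2 * Real.log (1 + (x - 0) ^ 2) =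
      Real.log (1 + ε ^ 2 * logSecondDiffRatio x ε) := by
  have h : 1 + ε ^ 2 * logSecondDiffRatio x ε =
      (1 + (x - ε) ^ 2) * (1 + (x - -ε) ^ 2) / (1 + (x - 0) ^ 2) ^ 2 := by
    unfold logSecondDiffRatio
    field_simp
    ring
  rw [h, Real.log_div (by positivity) (by positivity), Real.log_mul (by positivity)
    (by positivity), Real.log_pow]
  norm_num

lemma one_add_mul_logSecondDiffRatio_pos (x ε : ℝ) :
    0 < 1 + ε ^ 2 * logSecondDiffRatio x ε := by
  have h : 1 + ε ^ 2 * logSecondDiffRatio x ε =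
      (1 + (x - ε) ^ 2) * (1 + (x + ε) ^ 2) / (1 + x ^ 2) ^ 2 := by
    unfold logSecondDiffRatio
    field_simp
    ring
  rw [h]
  positivity

lemma abs_logSecondDiffRatio_le {ε : ℝ} (hε : ε ^ 2 ≤ 1) (x : ℝ) :
    |logSecondDiffRatio x ε| ≤ 3 := by
  have h0 : (0 : ℝ) < (1 + x ^ 2) ^ 2 := by positivity
  unfold logSecondDiffRatio
  rw [abs_le, le_div_iff₀ h0, div_le_iff₀ h0]
  constructor <;> nlinarith [sq_nonneg x, sq_nonneg ε, sq_nonneg (x ^ 2)]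

lemma log_one_add_div_bounds {a w : ℝ} (ha : 0 < a) (h : 0 < 1 + a * w) :
    w / (1 + a * w) ≤ Real.log (1 + a * w) / a ∧ Real.log (1 + a * w) / a ≤ w := by
  have h1 := Real.one_sub_inv_le_log_of_pos h
  have h2 := Real.log_le_sub_one_of_pos h
  constructor
  · rw [le_div_iff₀ ha]
    refine le_trans (le_of_eq ?_) h1
    have := h.ne'
    rw [inv_eq_one_div, div_mul_eq_mul_div, one_sub_div this]
    ring
  · rw [div_le_iff₀ ha]
    linarith

lemma tendsto_log_second_difference_div (x : ℝ) :
    Tendsto (fun ε : ℝ => Real.log (1 + ε ^ 2 * logSecondDiffRatio x ε) / ε ^ 2)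
      (nhdsWithin 0 (Set.Ioi 0)) (nhds (2 * (1 - x ^ 2) / (1 + x ^ 2) ^ 2)) := by
  have hw : Continuous (logSecondDiffRatio x) := by
    unfold logSecondDiffRatio
    fun_prop
  have hw0 : logSecondDiffRatio x 0 = 2 * (1 - x ^ 2) / (1 + x ^ 2) ^ 2 := by
    simp [logSecondDiffRatio]
  rw [← hw0]
  have hu : Tendsto (logSecondDiffRatio x) (nhdsWithin 0 (Set.Ioi 0))
      (nhds (logSecondDiffRatio x 0)) := hw.continuousWithinAt
  have hl : Tendsto (fun ε => logSecondDiffRatio x ε / (1 + ε ^ 2 * logSecondDiffRatio x ε))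
      (nhdsWithin 0 (Set.Ioi 0)) (nhds (logSecondDiffRatio x 0)) := by
    have hc : Continuous fun ε =>
        logSecondDiffRatio x ε / (1 + ε ^ 2 * logSecondDiffRatio x ε) :=
      hw.div (by fun_prop) fun ε => (one_add_mul_logSecondDiffRatio_pos x ε).ne'
    have := hc.continuousWithinAt (s := Set.Ioi 0) (x := 0)
    simpa [ContinuousWithinAt] using this
  refine tendsto_of_tendsto_of_tendsto_of_le_of_le' hl hu ?_ ?_ <;>
    filter_upwards [self_mem_nhdsWithin] with ε hε
  · exact (log_one_add_div_bounds (pow_pos hε 2) (one_add_mul_logSecondDiffRatio_pos x ε)).1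
  · exact (log_one_add_div_bounds (pow_pos hε 2) (one_add_mul_logSecondDiffRatio_pos x ε)).2

lemma abs_log_second_difference_div_le {ε : ℝ} (hε : 0 < ε) (hε' : ε ≤ 1 / 3) (x : ℝ) :
    |Real.log (1 + ε ^ 2 * logSecondDiffRatio x ε) / ε ^ 2| ≤ 6 := by
  have hsq : ε ^ 2 ≤ 1 / 9 := by nlinarith
  have hp := one_add_mul_logSecondDiffRatio_pos x ε
  obtain ⟨h1, h2⟩ := log_one_add_div_bounds (pow_pos hε 2) hp
  obtain ⟨h3, h4⟩ := abs_le.1 (abs_logSecondDiffRatio_le (hsq.trans (by norm_num)) x)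
  have h5 : -6 ≤ logSecondDiffRatio x ε / (1 + ε ^ 2 * logSecondDiffRatio x ε) := by
    rw [le_div_iff₀ hp]
    nlinarith [sq_nonneg ε]
  exact abs_le.2 ⟨by linarith, by linarith⟩

lemma pearsonF_sub_div_eq {m : ℝ} (hm : 1 / 2 < m) (ε : ℝ) :
    (pearsonF m ε - pearsonF m 0) / ε ^ 2 =
      (∫ x : ℝ, Real.log (1 + ε ^ 2 * logSecondDiffRatio x ε) / ε ^ 2 *
        (pearsonC m * (1 + x ^ 2) ^ (-m))) / 2 := by
  have h : pearsonF m ε + pearsonF m (-ε) - 2 * pearsonF m 0 =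
      ∫ x : ℝ, Real.log (1 + ε ^ 2 * logSecondDiffRatio x ε) *
        (pearsonC m * (1 + x ^ 2) ^ (-m)) := by
    have i1 := integrable_pearsonF_integrand hm ε
    have i2 := integrable_pearsonF_integrand hm (-ε)
    have i3 := (integrable_pearsonF_integrand hm 0).const_mul 2
    unfold pearsonF
    rw [← integral_add i1 i2, ← integral_const_mul]
    refine (integral_sub (i1.add i2) i3).symm.trans ?_
    refine integral_congr_ae (Eventually.of_forall fun x => ?_)
    simp only [Pi.add_apply]
    rw [← log_second_difference]
    ring
  simp only [div_mul_eq_mul_div]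
  rw [integral_div, ← h, pearsonF_neg]
  ring

lemma tendsto_pearsonF_sub_div {m : ℝ} (hm : 1 / 2 < m) :
    Tendsto (fun ε : ℝ => (pearsonF m ε - pearsonF m 0) / ε ^ 2) (nhdsWithin 0 (Set.Ioi 0))
      (nhds ((2 * m - 1) / (m + 1) / 2)) := by
  have hc := pearsonC_pos hm
  simp only [pearsonF_sub_div_eq hm]
  rw [← integral_second_deriv_log_mul_pearson hm]
  refine Tendsto.div_const ?_ 2
  refine tendsto_integral_filter_of_dominated_convergence
    (fun x => 6 * (pearsonC m * (1 + x ^ 2) ^ (-m))) ?_ ?_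
    (((integrable_one_add_sq_rpow_neg hm).const_mul _).const_mul _)
    (Eventually.of_forall fun x => (tendsto_log_second_difference_div x).mul_const _)
  · refine Eventually.of_forall fun ε => Continuous.aestronglyMeasurable ?_
    refine Continuous.mul (Continuous.div_const (Continuous.log ?_ fun x =>
      (one_add_mul_logSecondDiffRatio_pos x ε).ne') _)
      ((continuous_one_add_sq_rpow _).const_mul _)
    unfold logSecondDiffRatio
    exact continuous_const.add (continuous_const.mul
      (Continuous.div (by fun_prop) (by fun_prop) fun x => by positivity))
  · filter_upwards [Ioo_mem_nhdsGT (show (0 : ℝ) < 1 / 3 by norm_num)] with ε hε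
    refine Eventually.of_forall fun x => ?_
    have hp : 0 ≤ pearsonC m * (1 + x ^ 2) ^ (-m) := by positivity
    rw [norm_mul, Real.norm_eq_abs, Real.norm_eq_abs, abs_of_nonneg hp]
    exact mul_le_mul_of_nonneg_right (abs_log_second_difference_div_le hε.1 hε.2.le x) hp

theorem pearsonB_eq_and_limit (m : ℝ) (hm : 1 / 2 < m) :
    (∀ ε : ℝ, 0 < ε → pearsonB m ε = m * (pearsonF m ε - pearsonF m 0)) ∧
    Tendsto (fun ε : ℝ => pearsonB m ε / ε ^ 2) (nhdsWithin 0 (Set.Ioi 0))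
      (nhds (m * (2 * m - 1) / (2 * (m + 1)))) := by
  refine ⟨fun ε hε => pearsonB_eq hm hε, ?_⟩
  have h := (tendsto_pearsonF_sub_div hm).const_mul m
  rw [div_div, mul_comm (m + 1), ← mul_div_assoc] at h
  refine h.congr' ?_
  filter_upwards [self_mem_nhdsWithin] with ε hε
  rw [pearsonB_eq hm hε, mul_div_assoc]
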